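/- arXiv:1208.3324 — 2 statements merged into one kernel-verified Lean document; each statement's English description precedes it below -/
import Mathlib

section
/- If the triangle P1P2P3 is nondegenerate (the points are noncollinear) and the first weight condition is violated, i.e. m1² ≥ m2² + m3² + 2 m2 m3 cos α_1, then F attains its minimum over ℝ² at the vertex P1, i.e. F(x1,y1) ≤ F(x,y) for all (x,y) ∈ ℝ². -/
theorem ft_cs (s t p q M : ℝ) (hM : 0 ≤ M) (h : s^2 + t^2 ≤ M^2) :
    s * p + t * q ≤ M * Real.sqrt (p^2 + q^2) := by
  have h0 : 0 ≤ p^2 + q^2 := by positivity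
  refine abs_le_of_sq_le_sq' ?_ (by positivity) |>.2
  rw [mul_pow, Real.sq_sqrt h0]
  nlinarith [sq_nonneg (s * q - t * p), mul_le_mul_of_nonneg_right h h0]

/-- If the first weight condition is violated, `F` attains its minimum at the
vertex `P₁`. -/
theorem fermat_torricelli_vertex_case
    (x1 y1 x2 y2 x3 y3 m1 m2 m3 : ℝ)
    (hm1 : 0 < m1) (hm2 : 0 < m2) (hm3 : 0 < m3)
    (hnd : x1*y2 + x2*y3 + x3*y1 - x1*y3 - x3*y2 - x2*y1 ≠ 0)
    (r12 r13 : ℝ)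
    (hr12 : r12 = Real.sqrt ((x1-x2)^2 + (y1-y2)^2))
    (hr13 : r13 = Real.sqrt ((x1-x3)^2 + (y1-y3)^2))
    (cosα1 : ℝ)
    (hc1 : cosα1 = ((x2-x1)*(x3-x1) + (y2-y1)*(y3-y1)) / (r12 * r13))
    (hviol : m1^2 ≥ m2^2 + m3^2 + 2*m2*m3*cosα1)
    (F : ℝ → ℝ → ℝ)
    (hF : ∀ x y, F x y =
        m1 * Real.sqrt ((x-x1)^2 + (y-y1)^2)
      + m2 * Real.sqrt ((x-x2)^2 + (y-y2)^2)
      + m3 * Real.sqrt ((x-x3)^2 + (y-y3)^2)) :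
    ∀ x y : ℝ, F x1 y1 ≤ F x y := by
  intro x y
  have hpos2 : 0 < (x1-x2)^2 + (y1-y2)^2 := by
    by_contra hc
    have e1 : x1 - x2 = 0 := pow_eq_zero_iff two_ne_zero |>.1 (by linarith [sq_nonneg (x1-x2), sq_nonneg (y1-y2)])
    have e2 : y1 - y2 = 0 := pow_eq_zero_iff two_ne_zero |>.1 (by linarith [sq_nonneg (x1-x2), sq_nonneg (y1-y2)])
    apply hnd
    linear_combination (y3 - y2) * (-e1) + (x3 - x2) * e2
  have hpos3 : 0 < (x1-x3)^2 + (y1-y3)^2 := by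
    by_contra hc
    have e1 : x1 - x3 = 0 := pow_eq_zero_iff two_ne_zero |>.1 (by linarith [sq_nonneg (x1-x3), sq_nonneg (y1-y3)])
    have e2 : y1 - y3 = 0 := pow_eq_zero_iff two_ne_zero |>.1 (by linarith [sq_nonneg (x1-x3), sq_nonneg (y1-y3)])
    apply hnd
    linear_combination (y2 - y3) * e1 - (x2 - x3) * e2
  have h2 : 0 < r12 := hr12 ▸ Real.sqrt_pos.2 hpos2
  have h3 : 0 < r13 := hr13 ▸ Real.sqrt_pos.2 hpos3
  have s2 : r12^2 = (x1-x2)^2 + (y1-y2)^2 := by rw [hr12, Real.sq_sqrt hpos2.le]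
  have s3 : r13^2 = (x1-x3)^2 + (y1-y3)^2 := by rw [hr13, Real.sq_sqrt hpos3.le]
  obtain ⟨a, ha⟩ : ∃ a, a * r12 = x2 - x1 := ⟨(x2-x1)/r12, by field_simp⟩
  obtain ⟨b, hb⟩ : ∃ b, b * r12 = y2 - y1 := ⟨(y2-y1)/r12, by field_simp⟩
  obtain ⟨c, hc⟩ : ∃ c, c * r13 = x3 - x1 := ⟨(x3-x1)/r13, by field_simp⟩
  obtain ⟨d, hd⟩ : ∃ d, d * r13 = y3 - y1 := ⟨(y3-y1)/r13, by field_simp⟩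
  have n2 : a^2 + b^2 = 1 := by
    have : (a^2 + b^2) * r12^2 = 1 * r12^2 := by
      have : (a^2 + b^2) * r12^2 = (a*r12)^2 + (b*r12)^2 := by ring
      rw [this, ha, hb, s2]; ring
    exact mul_right_cancel₀ (by positivity) this
  have n3 : c^2 + d^2 = 1 := by
    have : (c^2 + d^2) * r13^2 = 1 * r13^2 := by
      have : (c^2 + d^2) * r13^2 = (c*r13)^2 + (d*r13)^2 := by ring
      rw [this, hc, hd, s3]; ring
    exact mul_right_cancel₀ (by positivity) this
  have hcos : cosα1 = a * c + b * d := by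
    rw [hc1, ← ha, ← hb, ← hc, ← hd]; field_simp
  have k1 := ft_cs (m2*a+m3*c) (m2*b+m3*d) (x-x1) (y-y1) m1 hm1.le (by
    rw [hcos] at hviol
    have : (m2*a+m3*c)^2 + (m2*b+m3*d)^2
        = m2^2 + m3^2 + 2*m2*m3*(a*c+b*d) := by
      linear_combination m2^2 * n2 + m3^2 * n3
    linarith)
  have k2 := ft_cs (-a) (-b) (x-x2) (y-y2) 1 zero_le_one (by rw [neg_sq, neg_sq]; linarith)
  have k3 := ft_cs (-c) (-d) (x-x3) (y-y3) 1 zero_le_one (by rw [neg_sq, neg_sq]; linarith)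
  have e2 : (-a) * (x-x2) + (-b) * (y-y2) = r12 - (a*(x-x1) + b*(y-y1)) := by
    linear_combination (-a) * ha - b * hb + r12 * n2
  have e3 : (-c) * (x-x3) + (-d) * (y-y3) = r13 - (c*(x-x1) + d*(y-y1)) := by
    linear_combination (-c) * hc - d * hd + r13 * n3
  rw [e2, one_mul] at k2
  rw [e3, one_mul] at k3
  have k2' := mul_le_mul_of_nonneg_left k2 hm2.le
  have k3' := mul_le_mul_of_nonneg_left k3 hm3.le
  rw [hF, hF, ← hr12, ← hr13]
  have z : Real.sqrt ((x1-x1)^2 + (y1-y1)^2) = 0 := by simp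
  rw [z]
  linarith
end

section
/- If all angles of the nondegenerate triangle P1P2P3 are less than 2π/3 (i.e. r12² + r13² + r12·r13 − r23² > 0, r23² + r12² + r12·r23 − r13² > 0, r13² + r23² + r13·r23 − r12² > 0), then the coordinates of the Fermat–Torricelli point (the minimizer of G) are given by the area-free formulas: x* = (1/(2√3 d))·[ (x1+x2+x3)|S̃| + √3(x1 r23² + x2 r13² + x3 r12²) + 3·sgn(S̃)·det[[1,1,1],[y1,y2,y3],[x2x3+y2y3, x1x3+y1y3, x1x2+y1y2]] ] and y* = (1/(2√3 d))·[ (y1+y2+y3)|S̃| + √3(y1 r23² + y2 r13² + y3 r12²) − 3·sgn(S̃)·det[[1,1,1],[x1,x2,x3],[x2x3+y2y3, x1x3+y1y3, x1x2+y1y2]] ]. -/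
/-- The weight `√3 c + S` is positive when the cosine of the angle is more than `-1/2`. -/
lemma ft_K_pos (s p q r c S : ℝ) (hs : 0 < s) (hs3 : s ^ 2 = 3) (hp : 0 ≤ p) (hq : 0 ≤ q)
    (hS : 0 < S) (hc : 2 * c = p ^ 2 + q ^ 2 - r ^ 2)
    (hcS : S ^ 2 + c ^ 2 = p ^ 2 * q ^ 2)
    (h : 0 < p ^ 2 + q ^ 2 + p * q - r ^ 2) : 0 < s * c + S := by
  rcases le_or_gt 0 c with h0 | h0
  · positivity
  · have h1 : 0 < p * q + 2 * c := by linarith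
    have h2 : 0 < (p * q + 2 * c) * (p * q - 2 * c) :=
      mul_pos h1 (by nlinarith [mul_nonneg hp hq])
    have h3 : (s * c) ^ 2 < S ^ 2 := by
      rw [mul_pow, hs3]; nlinarith
    have h4 := abs_lt.1 (abs_lt_of_sq_lt_sq h3 hS.le)
    linarith [h4.1]

/-- Cauchy–Schwarz in the plane. -/
lemma ft_cs_s11 (a b u v D : ℝ) (hD : 0 ≤ D) (h : u ^ 2 + v ^ 2 = D ^ 2) :
    a * u + b * v ≤ Real.sqrt (a ^ 2 + b ^ 2) * D := by
  have h1 : a * u + b * v ≤ Real.sqrt ((a ^ 2 + b ^ 2) * D ^ 2) := by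
    apply Real.le_sqrt_of_sq_le
    rw [← h]; nlinarith [sq_nonneg (a * v - b * u)]
  rwa [Real.sqrt_mul (by positivity), Real.sqrt_sq hD] at h1

lemma ft_cs_eq (a b u v D : ℝ) (h : u ^ 2 + v ^ 2 = D ^ 2)
    (he : a * u + b * v = Real.sqrt (a ^ 2 + b ^ 2) * D) : a * v - b * u = 0 := by
  have h1 : (a * u + b * v) ^ 2 = (a ^ 2 + b ^ 2) * D ^ 2 := by
    rw [he, mul_pow, Real.sq_sqrt (by positivity)]
  rw [← h] at h1
  have : (a * v - b * u) ^ 2 = 0 := by linarith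
  exact pow_eq_zero_iff (two_ne_zero) |>.1 this

/-- Uniqueness and minimality from the three balanced directions. -/
lemma ft_core (x1 y1 x2 y2 x3 y3 fx fy u1 v1 u2 v2 u3 v3 t1 t2 t3 D X Y : ℝ)
    (hD : 0 < D) (ht1 : 0 ≤ t1) (ht2 : 0 ≤ t2) (ht3 : 0 ≤ t3)
    (n1 : u1 ^ 2 + v1 ^ 2 = D ^ 2) (n2 : u2 ^ 2 + v2 ^ 2 = D ^ 2) (n3 : u3 ^ 2 + v3 ^ 2 = D ^ 2)
    (su : u1 + u2 + u3 = 0) (sv : v1 + v2 + v3 = 0) (hdet : u1 * v2 - u2 * v1 ≠ 0)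
    (a1 : fx - x1 = - (t1 * u1)) (b1 : fy - y1 = - (t1 * v1))
    (a2 : fx - x2 = - (t2 * u2)) (b2 : fy - y2 = - (t2 * v2))
    (a3 : fx - x3 = - (t3 * u3)) (b3 : fy - y3 = - (t3 * v3))
    (hmin : Real.sqrt ((X-x1)^2 + (Y-y1)^2) + Real.sqrt ((X-x2)^2 + (Y-y2)^2)
        + Real.sqrt ((X-x3)^2 + (Y-y3)^2) ≤
      Real.sqrt ((fx-x1)^2 + (fy-y1)^2) + Real.sqrt ((fx-x2)^2 + (fy-y2)^2)
        + Real.sqrt ((fx-x3)^2 + (fy-y3)^2)) : X = fx ∧ Y = fy := by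
  have key : ∀ t u v : ℝ, 0 ≤ t → u ^ 2 + v ^ 2 = D ^ 2 →
      Real.sqrt ((-(t*u))^2 + (-(t*v))^2) = t * D := by
    intro t u v ht h
    rw [show (-(t*u))^2 + (-(t*v))^2 = (t * D) ^ 2 by rw [mul_pow, ← h]; ring]
    exact Real.sqrt_sq (by positivity)
  rw [a1, b1, a2, b2, a3, b3, key _ _ _ ht1 n1, key _ _ _ ht2 n2, key _ _ _ ht3 n3] at hmin
  have m1 : (-u1) ^ 2 + (-v1) ^ 2 = D ^ 2 := by linarith
  have m2 : (-u2) ^ 2 + (-v2) ^ 2 = D ^ 2 := by linarith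
  have m3 : (-u3) ^ 2 + (-v3) ^ 2 = D ^ 2 := by linarith
  have c1 := ft_cs_s11 (X - x1) (Y - y1) _ _ D hD.le m1
  have c2 := ft_cs_s11 (X - x2) (Y - y2) _ _ D hD.le m2
  have c3 := ft_cs_s11 (X - x3) (Y - y3) _ _ D hD.le m3
  have hm := mul_le_mul_of_nonneg_right hmin hD.le
  have hsum : ((X - x1) * -u1 + (Y - y1) * -v1) + ((X - x2) * -u2 + (Y - y2) * -v2)
      + ((X - x3) * -u3 + (Y - y3) * -v3) = (t1 * D + t2 * D + t3 * D) * D := by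
    linear_combination (-(X - fx)) * su - (Y - fy) * sv - u1 * a1 - v1 * b1 - u2 * a2 - v2 * b2
      - u3 * a3 - v3 * b3 + t1 * n1 + t2 * n2 + t3 * n3
  have e1 := ft_cs_eq (X - x1) (Y - y1) _ _ D m1 (by linarith)
  have e2 := ft_cs_eq (X - x2) (Y - y2) _ _ D m2 (by linarith)
  have g1 : (X - fx) * v1 - (Y - fy) * u1 = 0 := by
    linear_combination -e1 - v1 * a1 + u1 * b1
  have g2 : (X - fx) * v2 - (Y - fy) * u2 = 0 := by
    linear_combination -e2 - v2 * a2 + u2 * b2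
  constructor
  · have : (u1 * v2 - u2 * v1) * (X - fx) = 0 := by linear_combination u1 * g2 - u2 * g1
    have := (mul_eq_zero.1 this).resolve_left hdet
    linarith
  · have : (u1 * v2 - u2 * v1) * (Y - fy) = 0 := by linear_combination v1 * g2 - v2 * g1
    have := (mul_eq_zero.1 this).resolve_left hdet
    linarith

lemma ft_div (s d N K w x : ℝ) (hs : s ≠ 0) (hd : d ≠ 0) (h : 2 * s * d * x - N = 2 * K * w) :
    (1 / (2 * s * d)) * N - x = -(K / (s * d) * w) := by
  have : N = 2 * s * d * x - 2 * K * w := by linarith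
  rw [this]
  field_simp
  ring

/-- Area-free formulas for the coordinates of the Fermat–Torricelli point
(the minimizer of the sum of distances), when all angles of the triangle are
less than `2π/3`. -/
theorem fermat_torricelli_area_free_formulas
    (x1 y1 x2 y2 x3 y3 : ℝ)
    (Stilde : ℝ)
    (hStilde : Stilde = Matrix.det !![(1:ℝ), 1, 1; x1, x2, x3; y1, y2, y3])
    (hnd : Stilde ≠ 0)
    (r12 r13 r23 S d : ℝ)
    (hr12 : r12 = Real.sqrt ((x1-x2)^2 + (y1-y2)^2))
    (hr13 : r13 = Real.sqrt ((x1-x3)^2 + (y1-y3)^2))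
    (hr23 : r23 = Real.sqrt ((x2-x3)^2 + (y2-y3)^2))
    (hS : S = |Stilde|)
    (hd : d = (r12^2 + r13^2 + r23^2)/2 + Real.sqrt 3 * S)
    (hang1 : 0 < r12^2 + r13^2 + r12*r13 - r23^2)
    (hang2 : 0 < r23^2 + r12^2 + r12*r23 - r13^2)
    (hang3 : 0 < r13^2 + r23^2 + r13*r23 - r12^2)
    (G : ℝ → ℝ → ℝ)
    (hG : ∀ x y, G x y =
        Real.sqrt ((x-x1)^2 + (y-y1)^2)
      + Real.sqrt ((x-x2)^2 + (y-y2)^2)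
      + Real.sqrt ((x-x3)^2 + (y-y3)^2))
    (xs ys : ℝ)
    (hmin : ∀ x y : ℝ, G xs ys ≤ G x y) :
    xs = (1/(2*Real.sqrt 3*d)) *
        ((x1 + x2 + x3) * |Stilde|
          + Real.sqrt 3 * (x1*r23^2 + x2*r13^2 + x3*r12^2)
          + 3 * Real.sign Stilde *
            Matrix.det !![(1:ℝ), 1, 1; y1, y2, y3;
              x2*x3 + y2*y3, x1*x3 + y1*y3, x1*x2 + y1*y2]) ∧
    ys = (1/(2*Real.sqrt 3*d)) *
        ((y1 + y2 + y3) * |Stilde|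
          + Real.sqrt 3 * (y1*r23^2 + y2*r13^2 + y3*r12^2)
          - 3 * Real.sign Stilde *
            Matrix.det !![(1:ℝ), 1, 1; x1, x2, x3;
              x2*x3 + y2*y3, x1*x3 + y1*y3, x1*x2 + y1*y2]) := by
  have h12 : r12 ^ 2 = (x1-x2)^2 + (y1-y2)^2 := by rw [hr12, Real.sq_sqrt (by positivity)]
  have h13 : r13 ^ 2 = (x1-x3)^2 + (y1-y3)^2 := by rw [hr13, Real.sq_sqrt (by positivity)]
  have h23 : r23 ^ 2 = (x2-x3)^2 + (y2-y3)^2 := by rw [hr23, Real.sq_sqrt (by positivity)]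
  have p12 : 0 ≤ r12 := hr12 ▸ Real.sqrt_nonneg _
  have p13 : 0 ≤ r13 := hr13 ▸ Real.sqrt_nonneg _
  have p23 : 0 ≤ r23 := hr23 ▸ Real.sqrt_nonneg _
  clear hr12 hr13 hr23
  have hSpos : 0 < S := hS ▸ abs_pos.2 hnd
  obtain ⟨s, hs⟩ : ∃ s, s = Real.sqrt 3 := ⟨_, rfl⟩
  have hs0 : 0 < s := hs ▸ Real.sqrt_pos.2 (by norm_num)
  have hs3 : s ^ 2 = 3 := by rw [hs, Real.sq_sqrt (by norm_num)]
  rw [← hs] at hd ⊢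
  have hd0 : 0 < d := by rw [hd]; positivity
  obtain ⟨σ, hσ⟩ : ∃ σ, σ = Real.sign Stilde := ⟨_, rfl⟩
  have hSσ : S = σ * Stilde ∧ σ ^ 2 = 1 := by
    rcases lt_or_gt_of_ne hnd with h | h
    · rw [hσ, Real.sign_of_neg h, hS, abs_of_neg h]; norm_num
    · rw [hσ, Real.sign_of_pos h, hS, abs_of_pos h]; norm_num
  obtain ⟨hSσ, hσ2⟩ := hSσ
  rw [← hσ, ← hS]
  simp only [Matrix.det_fin_three, Matrix.of_apply, Matrix.cons_val', Matrix.cons_val_zero,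
    Matrix.cons_val_one, Matrix.cons_val] at hStilde ⊢
  clear hs hS hσ
  have hSt : Stilde = (x2-x1)*(y3-y1) - (x3-x1)*(y2-y1) := by rw [hStilde]; ring
  clear hStilde
  have hS2 : S ^ 2 = Stilde ^ 2 := by rw [hSσ, mul_pow, hσ2, one_mul]
  have K1 := ft_K_pos s r12 r13 r23 ((r12^2+r13^2-r23^2)/2) S hs0 hs3 p12 p13 hSpos (by ring)
    (by rw [hS2, hSt, h12, h13, h23]; ring) hang1
  have K2 := ft_K_pos s r23 r12 r13 ((r23^2+r12^2-r13^2)/2) S hs0 hs3 p23 p12 hSpos (by ring)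
    (by rw [hS2, hSt, h12, h13, h23]; ring) (by linarith)
  have K3 := ft_K_pos s r13 r23 r12 ((r13^2+r23^2-r12^2)/2) S hs0 hs3 p13 p23 hSpos (by ring)
    (by rw [hS2, hSt, h12, h13, h23]; ring) hang3
  have hm := hmin ((1/(2*s*d)) *
        ((x1 + x2 + x3) * S + s * (x1*r23^2 + x2*r13^2 + x3*r12^2)
          + 3 * σ * (y1*((x1*x3+y1*y3) - (x1*x2+y1*y2)) + y2*((x1*x2+y1*y2) - (x2*x3+y2*y3))
            + y3*((x2*x3+y2*y3)-(x1*x3+y1*y3)))))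
      ((1/(2*s*d)) *
        ((y1 + y2 + y3) * S + s * (y1*r23^2 + y2*r13^2 + y3*r12^2)
          - 3 * σ * (x1*((x1*x3+y1*y3) - (x1*x2+y1*y2)) + x2*((x1*x2+y1*y2) - (x2*x3+y2*y3))
            + x3*((x2*x3+y2*y3)-(x1*x3+y1*y3)))))
  rw [hG, hG] at hm
  have hDsq : Real.sqrt d ^ 2 = d := Real.sq_sqrt hd0.le
  have hdne : d ≠ 0 := hd0.ne'
  have hsne : s ≠ 0 := hs0.ne'
  have hfin := ft_core x1 y1 x2 y2 x3 y3 _ _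
    (x1 - (x2+x3)/2 + s/2*σ*(y2-y3)) (y1 - (y2+y3)/2 - s/2*σ*(x2-x3))
    (x2 - (x3+x1)/2 + s/2*σ*(y3-y1)) (y2 - (y3+y1)/2 - s/2*σ*(x3-x1))
    (x3 - (x1+x2)/2 + s/2*σ*(y1-y2)) (y3 - (y1+y2)/2 - s/2*σ*(x1-x2))
    ((s * ((r12^2+r13^2-r23^2)/2) + S) / (s*d))
    ((s * ((r23^2+r12^2-r13^2)/2) + S) / (s*d))
    ((s * ((r13^2+r23^2-r12^2)/2) + S) / (s*d)) (Real.sqrt d) xs ys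
    (Real.sqrt_pos.2 hd0) (by positivity) (by positivity) (by positivity)
    ?_ ?_ ?_ (by ring) (by ring) ?_ ?_ ?_ ?_ ?_ ?_ ?_ hm
  · constructor
    · rw [hfin.1]; ring
    · rw [hfin.2]; ring
  · rw [hDsq, hd, h12, h13, h23, hSσ, hSt]
    linear_combination (σ^2/4*((x2-x3)^2+(y2-y3)^2)) * hs3
      + 3/4*((x2-x3)^2+(y2-y3)^2) * hσ2
  · rw [hDsq, hd, h12, h13, h23, hSσ, hSt]
    linear_combination (σ^2/4*((x3-x1)^2+(y3-y1)^2)) * hs3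
      + 3/4*((x3-x1)^2+(y3-y1)^2) * hσ2
  · rw [hDsq, hd, h12, h13, h23, hSσ, hSt]
    linear_combination (σ^2/4*((x1-x2)^2+(y1-y2)^2)) * hs3
      + 3/4*((x1-x2)^2+(y1-y2)^2) * hσ2
  · have : (x1 - (x2+x3)/2 + s/2*σ*(y2-y3)) * (y2 - (y3+y1)/2 - s/2*σ*(x3-x1))
        - (x2 - (x3+x1)/2 + s/2*σ*(y3-y1)) * (y1 - (y2+y3)/2 - s/2*σ*(x2-x3)) = s/2*σ*d := by
      rw [hd, h12, h13, h23, hSσ, hSt]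
      linear_combination (σ^2*((-(y2-y3)*(x3-x1) + (y3-y1)*(x2-x3))/4 - ((x2-x1)*(y3-y1) - (x3-x1)*(y2-y1))/2)) * hs3
        + 3*((-(y2-y3)*(x3-x1) + (y3-y1)*(x2-x3))/4 - ((x2-x1)*(y3-y1) - (x3-x1)*(y2-y1))/2) * hσ2
    rw [this]
    have hσ0 : σ ≠ 0 := by rintro rfl; norm_num at hσ2
    positivity
  · apply ft_div _ _ _ _ _ _ hsne hdne
    rw [hd, h12, h13, h23, hSσ, hSt]
    linear_combination (2*σ*((x2-x1)*(y3-y1) - (x3-x1)*(y2-y1))*x1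
        - (((x1-x2)^2+(y1-y2)^2)+((x1-x3)^2+(y1-y3)^2)-((x2-x3)^2+(y2-y3)^2))/2*σ*(y2-y3)) * hs3
      + (-s*((x2-x1)*(y3-y1) - (x3-x1)*(y2-y1))*(y2-y3)) * hσ2
  · apply ft_div _ _ _ _ _ _ hsne hdne
    rw [hd, h12, h13, h23, hSσ, hSt]
    linear_combination (2*σ*((x2-x1)*(y3-y1) - (x3-x1)*(y2-y1))*y1
        + (((x1-x2)^2+(y1-y2)^2)+((x1-x3)^2+(y1-y3)^2)-((x2-x3)^2+(y2-y3)^2))/2*σ*(x2-x3)) * hs3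
      + (s*((x2-x1)*(y3-y1) - (x3-x1)*(y2-y1))*(x2-x3)) * hσ2
  · apply ft_div _ _ _ _ _ _ hsne hdne
    rw [hd, h12, h13, h23, hSσ, hSt]
    linear_combination (2*σ*((x2-x1)*(y3-y1) - (x3-x1)*(y2-y1))*x2
        - (((x2-x3)^2+(y2-y3)^2)+((x2-x1)^2+(y2-y1)^2)-((x3-x1)^2+(y3-y1)^2))/2*σ*(y3-y1)) * hs3
      + (-s*((x2-x1)*(y3-y1) - (x3-x1)*(y2-y1))*(y3-y1)) * hσ2
  · apply ft_div _ _ _ _ _ _ hsne hdne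
    rw [hd, h12, h13, h23, hSσ, hSt]
    linear_combination (2*σ*((x2-x1)*(y3-y1) - (x3-x1)*(y2-y1))*y2
        + (((x2-x3)^2+(y2-y3)^2)+((x2-x1)^2+(y2-y1)^2)-((x3-x1)^2+(y3-y1)^2))/2*σ*(x3-x1)) * hs3
      + (s*((x2-x1)*(y3-y1) - (x3-x1)*(y2-y1))*(x3-x1)) * hσ2
  · apply ft_div _ _ _ _ _ _ hsne hdne
    rw [hd, h12, h13, h23, hSσ, hSt]
    linear_combination (2*σ*((x2-x1)*(y3-y1) - (x3-x1)*(y2-y1))*x3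
        - (((x3-x1)^2+(y3-y1)^2)+((x3-x2)^2+(y3-y2)^2)-((x1-x2)^2+(y1-y2)^2))/2*σ*(y1-y2)) * hs3
      + (-s*((x2-x1)*(y3-y1) - (x3-x1)*(y2-y1))*(y1-y2)) * hσ2
  · apply ft_div _ _ _ _ _ _ hsne hdne
    rw [hd, h12, h13, h23, hSσ, hSt]
    linear_combination (2*σ*((x2-x1)*(y3-y1) - (x3-x1)*(y2-y1))*y3
        + (((x3-x1)^2+(y3-y1)^2)+((x3-x2)^2+(y3-y2)^2)-((x1-x2)^2+(y1-y2)^2))/2*σ*(x1-x2)) * hs3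
      + (s*((x2-x1)*(y3-y1) - (x3-x1)*(y2-y1))*(x1-x2)) * hσ2
end
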